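/- Let g = 3, let X ≥ 2 and X^{1/6} ≤ Z ≤ X be real, and set W = Z², U = 2^4 Z^3, V = 2^4 Z^3 X^{-1/2}. For an integer δ with 1 ≤ δ ≤ V, let T_3(δ) be the number of pairs of triples (w₁, u₁, v₁) ≠ (w₂, u₂, v₂) of positive integers satisfying: W ≤ w₁, w₂ < 4W, u₁, u₂ ≤ U, v₁, v₂ ≤ V; each wᵢ = p₁p₂ for some distinct primes p₁, p₂ ∈ [Z, 2Z); gcd(w₁, v₁) = gcd(w₂, v₂) = 1; v₁² divides 4w₁³ − u₁² and v₂² divides 4w₂³ − u₂²; (4w₁³ − u₁²)/v₁² = (4w₂³ − u₂²)/v₂² is a nonzero squarefree integer lying in [X, 2X); gcd(w₁, w₂) = 1; and gcd(v₁, v₂) = δ. Then for every ε > 0 there is a constant C = C(ε) (independent of X, Z, δ) such that T_3(δ) ≤ C · X^ε · ( W² V^{2/3} δ^{-2/3} + V³ U δ^{-3} + W V δ^{-1} ). -/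

import Mathlib

/-- `T3delta X Z δ` counts pairs of distinct triples `(w₁,u₁,v₁) ≠ (w₂,u₂,v₂)` of
positive integers with (writing `W = Z²`, `U = 2⁴Z³`, `V = 2⁴Z³X^(-1/2)`):
`W ≤ wᵢ < 4W`, `uᵢ ≤ U`, `vᵢ ≤ V`; each `wᵢ = p₁p₂` for distinct primes
`p₁, p₂ ∈ [Z,2Z)`; `gcd(wᵢ, vᵢ) = 1`; `vᵢ² ∣ 4wᵢ³ − uᵢ²`;
`(4w₁³−u₁²)/v₁² = (4w₂³−u₂²)/v₂²` a nonzero squarefree integer in `[X,2X)`;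
`gcd(w₁,w₂) = 1`; and `gcd(v₁,v₂) = δ`. -/
noncomputable def T3delta (X Z : ℝ) (δ : ℕ) : ℕ :=
  Nat.card {t : (ℕ × ℕ × ℕ) × (ℕ × ℕ × ℕ) //
    t.1 ≠ t.2 ∧
    (∀ s ∈ [t.1, t.2],
      Z ^ 2 ≤ (s.1 : ℝ) ∧ (s.1 : ℝ) < 4 * Z ^ 2 ∧
      0 < s.2.1 ∧ (s.2.1 : ℝ) ≤ 2 ^ 4 * Z ^ 3 ∧
      0 < s.2.2 ∧ (s.2.2 : ℝ) ≤ 2 ^ 4 * Z ^ 3 * X ^ (-(1 : ℝ) / 2) ∧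
      (∃ p₁ p₂ : ℕ, p₁.Prime ∧ p₂.Prime ∧ p₁ ≠ p₂ ∧
        Z ≤ p₁ ∧ (p₁ : ℝ) < 2 * Z ∧ Z ≤ p₂ ∧ (p₂ : ℝ) < 2 * Z ∧ s.1 = p₁ * p₂) ∧
      Nat.gcd s.1 s.2.2 = 1 ∧
      ((s.2.2 : ℤ) ^ 2 ∣ 4 * (s.1 : ℤ) ^ 3 - (s.2.1 : ℤ) ^ 2)) ∧
    (∃ e : ℤ, e ≠ 0 ∧ Squarefree e ∧ X ≤ (e : ℝ) ∧ (e : ℝ) < 2 * X ∧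
      4 * (t.1.1 : ℤ) ^ 3 - (t.1.2.1 : ℤ) ^ 2 = e * (t.1.2.2 : ℤ) ^ 2 ∧
      4 * (t.2.1 : ℤ) ^ 3 - (t.2.2.1 : ℤ) ^ 2 = e * (t.2.2.2 : ℤ) ^ 2) ∧
    Nat.gcd t.1.1 t.2.1 = 1 ∧
    Nat.gcd t.1.2.2 t.2.2.2 = δ}

theorem exists_card_divisors_le_rpow (η : ℝ) (hη : 0 < η) :
    ∃ C : ℝ, 1 ≤ C ∧ ∀ n : ℕ, n ≠ 0 → (n.divisors.card : ℝ) ≤ C * (n : ℝ) ^ η := by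
  obtain ⟨B, hB⟩ := exists_nat_gt ((2 : ℝ) ^ (1 / η))
  have hlog : 0 < Real.log 2 := Real.log_pos one_lt_two
  set K : ℝ := max 1 (1 / (η * Real.log 2)) with hK
  have hK1 : 1 ≤ K := le_max_left _ _
  have hKη : 1 ≤ K * (η * Real.log 2) := by
    have h := mul_le_mul_of_nonneg_right (le_max_right 1 (1 / (η * Real.log 2)))
      (mul_pos hη hlog).le
    rwa [one_div_mul_cancel (mul_pos hη hlog).ne'] at h
  refine ⟨K ^ B, one_le_pow₀ hK1, fun n hn => ?_⟩
  have hlocal : ∀ p ∈ n.primeFactors, ((n.factorization p + 1 : ℕ) : ℝ) ≤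
      (if p < B then K else 1) * ((p ^ n.factorization p : ℕ) : ℝ) ^ η := by
    intro p hp
    have hp2 : (2 : ℝ) ≤ p := by exact_mod_cast (Nat.prime_of_mem_primeFactors hp).two_le
    generalize n.factorization p = k
    have hpow : ((p ^ k : ℕ) : ℝ) ^ η = ((p : ℝ) ^ η) ^ k := by
      push_cast
      rw [← Real.rpow_natCast, ← Real.rpow_mul (by positivity), mul_comm,
        Real.rpow_mul (by positivity), Real.rpow_natCast]
    rw [hpow]
    push_cast
    split_ifs with hpB
    · have h1 : (2 : ℝ) ^ η ≤ (p : ℝ) ^ η := Real.rpow_le_rpow (by norm_num) hp2 hη.le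
      have h2 : 1 + k * (η * Real.log 2) ≤ ((2 : ℝ) ^ η) ^ k := by
        rw [Real.rpow_def_of_pos two_pos, ← Real.exp_nat_mul]
        have := Real.add_one_le_exp (k * (Real.log 2 * η))
        linarith
      have h3 : ((2 : ℝ) ^ η) ^ k ≤ ((p : ℝ) ^ η) ^ k := by gcongr
      have hk : (0 : ℝ) ≤ k := by positivity
      calc (k : ℝ) + 1 ≤ K * (1 + k * (η * Real.log 2)) := by nlinarith
        _ ≤ _ := by gcongr; linarith
    · have hpB' : (B : ℝ) ≤ p := by exact_mod_cast not_lt.mp hpB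
      have h1 : (2 : ℝ) ≤ (p : ℝ) ^ η := by
        calc (2 : ℝ) = ((2 : ℝ) ^ (1 / η)) ^ η := by
              rw [← Real.rpow_mul (by norm_num), one_div_mul_cancel hη.ne', Real.rpow_one]
          _ ≤ (p : ℝ) ^ η := Real.rpow_le_rpow (by positivity) (hB.le.trans hpB') hη.le
      have h2 : (k : ℝ) + 1 ≤ 2 ^ k := by exact_mod_cast Nat.lt_two_pow_self
      rw [one_mul]
      exact h2.trans (by gcongr)
  have hprod : ((n.divisors.card : ℕ) : ℝ) =
      ∏ p ∈ n.primeFactors, ((n.factorization p + 1 : ℕ) : ℝ) := by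
    rw [Nat.card_divisors hn]; push_cast; rfl
  have hn_pow : (n : ℝ) ^ η = ∏ p ∈ n.primeFactors, ((p ^ n.factorization p : ℕ) : ℝ) ^ η := by
    rw [Real.finsetProd_rpow _ _ (fun _ _ => by positivity), ← Nat.cast_prod]
    congr 2
    exact (Nat.prod_factorization_pow_eq_self hn).symm
  have hK_prod : ∏ p ∈ n.primeFactors, (if p < B then K else 1) ≤ K ^ B := by
    rw [Finset.prod_ite, Finset.prod_const_one, mul_one, Finset.prod_const]
    refine pow_le_pow_right₀ hK1 ?_
    calc _ ≤ (Finset.range B).card := Finset.card_le_card fun p hp => by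
          simpa using (Finset.mem_filter.mp hp).2
      _ = B := Finset.card_range B
  rw [hprod, hn_pow]
  calc _ ≤ ∏ p ∈ n.primeFactors,
        ((if p < B then K else 1) * ((p ^ n.factorization p : ℕ) : ℝ) ^ η) :=
        Finset.prod_le_prod (fun _ _ => by positivity) hlocal
    _ ≤ _ := by
        rw [Finset.prod_mul_distrib]
        gcongr

theorem card_cube_eq_one_prime_pow_le (p k : ℕ) (hp : p.Prime) :
    Nat.card {x : (ZMod (p ^ k))ˣ // x ^ 3 = 1} ≤ 3 := by
  classical
  have : NeZero (p ^ k) := ⟨pow_ne_zero k hp.ne_zero⟩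
  rcases eq_or_ne p 2 with rfl | hp2
  · have : Subsingleton {x : (ZMod (2 ^ k))ˣ // x ^ 3 = 1} := by
      have key : ∀ x : (ZMod (2 ^ k))ˣ, x ^ 3 = 1 → x = 1 := by
        intro x hx
        have h1 : orderOf x ∣ 3 := orderOf_dvd_of_pow_eq_one hx
        have h2 : orderOf x ∣ 2 ^ k := by
          refine (orderOf_dvd_card (x := x)).trans ?_
          rw [ZMod.card_units_eq_totient]
          rcases k with _ | k
          · simp
          · rw [Nat.totient_prime_pow_succ Nat.prime_two]
            simp [pow_succ]
        have h3 : Nat.Coprime 3 (2 ^ k) := Nat.Coprime.pow_right _ (by norm_num)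
        exact orderOf_eq_one_iff.mp (Nat.eq_one_of_dvd_coprimes h3 h1 h2)
      exact ⟨fun x y => Subtype.ext ((key _ x.2).trans (key _ y.2).symm)⟩
    exact (Finite.card_le_one_iff_subsingleton.mpr this).trans (by norm_num)
  · have := ZMod.isCyclic_units_of_prime_pow p hp hp2 k
    rw [Nat.card_eq_fintype_card, Fintype.card_subtype]
    exact IsCyclic.card_pow_eq_one_le (by norm_num)

theorem card_cube_eq_one_mul {m n : ℕ} (h : m.Coprime n) :
    Nat.card {x : (ZMod (m * n))ˣ // x ^ 3 = 1} =
      Nat.card {x : (ZMod m)ˣ // x ^ 3 = 1} * Nat.card {x : (ZMod n)ˣ // x ^ 3 = 1} := by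
  let e := (Units.mapEquiv (ZMod.chineseRemainder h).toMulEquiv).trans MulEquiv.prodUnits
  rw [← Nat.card_prod]
  refine Nat.card_congr ((e.toEquiv.subtypeEquiv (q := fun y => y.1 ^ 3 = 1 ∧ y.2 ^ 3 = 1)
    fun x => ?_).trans (Equiv.subtypeProdEquivProd (p := fun y => y ^ 3 = 1)
    (q := fun y => y ^ 3 = 1)))
  have : (e x) ^ 3 = 1 ↔ x ^ 3 = 1 := by rw [← map_pow, map_eq_one_iff e e.injective]
  rw [← this, Prod.ext_iff]
  rfl

theorem card_cube_eq_one_le (n : ℕ) (hn : n ≠ 0) :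
    Nat.card {x : (ZMod n)ˣ // x ^ 3 = 1} ≤ n.divisors.card ^ 2 := by
  induction n using Nat.recOnPosPrimePosCoprime with
  | prime_pow p k hp hk =>
    refine (card_cube_eq_one_prime_pow_le p k hp).trans ?_
    rw [Nat.divisors_prime_pow hp, Finset.card_map, Finset.card_range]
    nlinarith
  | zero => exact absurd rfl hn
  | one =>
    have : Subsingleton (ZMod 1)ˣ := inferInstance
    exact (Finite.card_le_one_iff_subsingleton.mpr inferInstance).trans (by simp)
  | coprime a b ha hb hab iha ihb =>
    rw [card_cube_eq_one_mul hab, hab.card_divisors_mul, mul_pow]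
    exact Nat.mul_le_mul (iha (by omega)) (ihb (by omega))

/-- A set of units modulo `n` having a common cube has at most `d(n)²` elements. -/
theorem card_le_of_isUnit_of_cube_eq {n : ℕ} (hn : n ≠ 0) (R : Finset (ZMod n))
    (hu : ∀ x ∈ R, IsUnit x) (hR : ∀ x ∈ R, ∀ y ∈ R, x ^ 3 = y ^ 3) :
    R.card ≤ n.divisors.card ^ 2 := by
  have : NeZero n := ⟨hn⟩
  rcases R.eq_empty_or_nonempty with rfl | ⟨r, hr⟩
  · simp
  refine le_trans ?_ (card_cube_eq_one_le n hn)
  obtain ⟨ρ, hρ⟩ := hu r hr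
  rw [← Fintype.card_coe R, ← Nat.card_eq_fintype_card]
  choose f hf using fun x : R => hu x.1 x.2
  refine Nat.card_le_card_of_injective
    (fun x : R => (⟨f x * ρ⁻¹, ?_⟩ : {x : (ZMod n)ˣ // x ^ 3 = 1})) ?_
  · rw [mul_pow, inv_pow, mul_inv_eq_one]
    ext
    push_cast
    rw [hf, hρ]
    exact hR _ x.2 _ hr
  · intro x y hxy
    have h : f x = f y := mul_right_cancel (congrArg Subtype.val hxy)
    rw [Subtype.ext_iff, ← hf x, ← hf y, h]

theorem card_le_two_mul_card_divisors {N : ℤ} (hN : N ≠ 0) (K : Finset ℤ)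
    (hK : ∀ k ∈ K, k ∣ N) : K.card ≤ 2 * N.natAbs.divisors.card := by
  classical
  have hsub : K ⊆ N.natAbs.divisors.image (fun d : ℕ => (d : ℤ)) ∪
      N.natAbs.divisors.image (fun d : ℕ => -(d : ℤ)) := by
    intro k hk
    have hmem : k.natAbs ∈ N.natAbs.divisors :=
      Nat.mem_divisors.mpr ⟨Int.natAbs_dvd_natAbs.mpr (hK k hk), Int.natAbs_ne_zero.mpr hN⟩
    rw [Finset.mem_union, Finset.mem_image, Finset.mem_image]
    rcases Int.natAbs_eq k with h | h
    · exact Or.inl ⟨_, hmem, h.symm⟩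
    · exact Or.inr ⟨_, hmem, h.symm⟩
  refine (Finset.card_le_card hsub).trans ((Finset.card_union_le _ _).trans ?_)
  rw [two_mul]
  exact add_le_add Finset.card_image_le Finset.card_image_le

theorem exists_dvd_of_dvd_four_mul {N : ℕ} (hN : N ≠ 0) :
    ∃ n : ℕ, n ≠ 0 ∧ n ∣ N ∧ N ∣ 4 * n ∧ ∀ z : ℤ, (N : ℤ) ∣ 4 * z → (n : ℤ) ∣ z := by
  have hg : 0 < N.gcd 4 := Nat.gcd_pos_of_pos_right _ (by norm_num)
  obtain ⟨n, hn⟩ := Nat.gcd_dvd_left N 4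
  obtain ⟨f, hf⟩ := Nat.gcd_dvd_right N 4
  have hcop : n.Coprime f := by
    have h := Nat.coprime_div_gcd_div_gcd hg
    rwa [Nat.div_eq_of_eq_mul_right hg hn, Nat.div_eq_of_eq_mul_right hg hf] at h
  refine ⟨n, fun h => hN (by rw [hn, h, mul_zero]), ⟨_, by rw [mul_comm]; exact hn⟩,
    ⟨f, ?_⟩, fun z hz => ?_⟩
  · calc 4 * n = N.gcd 4 * f * n := by rw [← hf]
      _ = N.gcd 4 * n * f := by ring
      _ = N * f := by rw [← hn]
  · have h1 : ((N.gcd 4 : ℕ) : ℤ) * n ∣ (N.gcd 4 : ℕ) * (f * z) := by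
      have e1 : ((N.gcd 4 : ℕ) : ℤ) * n = N := by exact_mod_cast hn.symm
      have e2 : ((N.gcd 4 : ℕ) : ℤ) * (f * z) = 4 * z := by
        rw [← mul_assoc]
        congr 1
        exact_mod_cast hf.symm
      rwa [e1, e2]
    have h2 : (n : ℤ) ∣ f * z := Int.dvd_of_mul_dvd_mul_left (by exact_mod_cast hg.ne') h1
    exact (Nat.isCoprime_iff_coprime.mpr hcop).dvd_of_dvd_mul_left h2

theorem coprime_of_dvd_cube_sub {m w₁ w₂ a b : ℕ}
    (h : (m : ℤ) ∣ (w₁ : ℤ) ^ 3 * (b : ℤ) ^ 2 - (w₂ : ℤ) ^ 3 * (a : ℤ) ^ 2)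
    (hw : w₁.Coprime w₂) (h₁ : w₁.Coprime a) (hab : a.Coprime b) :
    m.Coprime w₁ ∧ m.Coprime a := by
  constructor
  · refine Nat.eq_one_of_dvd_coprimes (k := m.gcd w₁)
      (Nat.Coprime.mul_right (hw.pow_right 3) (h₁.pow_right 2)) (Nat.gcd_dvd_right _ _) ?_
    have hd := (Int.natCast_dvd_natCast.mpr (Nat.gcd_dvd_left m w₁)).trans h
    have hd' : ((m.gcd w₁ : ℕ) : ℤ) ∣ (w₁ : ℤ) ^ 3 * (b : ℤ) ^ 2 :=
      ((Int.natCast_dvd_natCast.mpr (Nat.gcd_dvd_right m w₁)).trans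
        (dvd_pow_self _ (by norm_num))).mul_right _
    exact_mod_cast (dvd_sub_right hd').mp hd
  · refine Nat.eq_one_of_dvd_coprimes (k := m.gcd a)
      (Nat.Coprime.mul_right (h₁.symm.pow_right 3) (hab.pow_right 2)) (Nat.gcd_dvd_right _ _) ?_
    have hd := (Int.natCast_dvd_natCast.mpr (Nat.gcd_dvd_left m a)).trans h
    have hd' : ((m.gcd a : ℕ) : ℤ) ∣ (w₂ : ℤ) ^ 3 * (a : ℤ) ^ 2 :=
      ((Int.natCast_dvd_natCast.mpr (Nat.gcd_dvd_right m a)).trans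
        (dvd_pow_self _ (by norm_num))).mul_left _
    exact_mod_cast (dvd_sub_left hd').mp hd

theorem card_image_cast_le {n a b : ℕ} {k : ℤ} (hn : n ≠ 0) (hna : n ∣ a)
    (hna' : ∀ z : ℤ, (a : ℤ) ∣ 4 * z → (n : ℤ) ∣ z) (hab : a.Coprime b) {ι : Type*}
    (F : Finset ι) (w : ι → ℕ)
    (hF : ∀ p ∈ F, (w p).Coprime a ∧ (a : ℤ) ∣ 4 * (w p : ℤ) ^ 3 * (b : ℤ) ^ 2 - k ^ 2) :
    (F.image fun p => (w p : ZMod n)).card ≤ n.divisors.card ^ 2 := by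
  classical
  refine card_le_of_isUnit_of_cube_eq hn _ ?_ ?_
  · intro x hx
    obtain ⟨p, hp, rfl⟩ := Finset.mem_image.mp hx
    exact (ZMod.isUnit_iff_coprime _ _).mpr ((hF p hp).1.of_dvd_right hna)
  · intro x hx y hy
    obtain ⟨p, hp, rfl⟩ := Finset.mem_image.mp hx
    obtain ⟨q, hq, rfl⟩ := Finset.mem_image.mp hy
    have h1 := dvd_sub (hF p hp).2 (hF q hq).2
    have h2 : (a : ℤ) ∣ (b : ℤ) ^ 2 * (4 * ((w p : ℤ) ^ 3 - (w q : ℤ) ^ 3)) := by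
      have e : (b : ℤ) ^ 2 * (4 * ((w p : ℤ) ^ 3 - (w q : ℤ) ^ 3)) =
          4 * (w p : ℤ) ^ 3 * (b : ℤ) ^ 2 - k ^ 2 - (4 * (w q : ℤ) ^ 3 * (b : ℤ) ^ 2 - k ^ 2) := by
        ring
      rwa [e]
    have hcop : IsCoprime (a : ℤ) ((b : ℤ) ^ 2) := (Nat.isCoprime_iff_coprime.mpr hab).pow_right
    have h3 := hna' _ (hcop.dvd_of_dvd_mul_left h2)
    rw [← ZMod.intCast_zmod_eq_zero_iff_dvd] at h3
    push_cast at h3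
    exact sub_eq_zero.mp h3

theorem card_fiber_le {a b τ : ℕ} {k : ℤ} (ha : a ≠ 0) (hb : b ≠ 0) (hk : k ≠ 0)
    (hab : a.Coprime b)
    (hτ : ∀ n : ℕ, n ∣ a ∨ n ∣ b ∨ n ∣ k.natAbs → n.divisors.card ≤ τ)
    (F : Finset (ℕ × ℕ))
    (hF : ∀ p ∈ F, p.1.Coprime p.2 ∧ p.1.Coprime a ∧ p.2.Coprime b ∧
      k ∣ 4 * ((p.1 : ℤ) ^ 3 * (b : ℤ) ^ 2 - (p.2 : ℤ) ^ 3 * (a : ℤ) ^ 2) ∧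
      (a : ℤ) ∣ 4 * (p.1 : ℤ) ^ 3 * (b : ℤ) ^ 2 - k ^ 2 ∧
      (b : ℤ) ∣ 4 * (p.2 : ℤ) ^ 3 * (a : ℤ) ^ 2 - k ^ 2)
    (B : Finset (ℤ × ℤ))
    (hB : ∀ x y : ℤ, (x, y) ≠ 0 → k ∣ 4 * (a * x ^ 3 - b * y ^ 3) →
      (∃ p ∈ F, ∃ q ∈ F, (a : ℤ) * x = 4 * (p.1 - q.1) ∧ (b : ℤ) * y = 4 * (p.2 - q.2)) →
      (x, y) ∈ B) :
    F.card ≤ (B.card + 1) * (τ ^ 2 * (τ ^ 2 * τ ^ 2)) := by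
  classical
  obtain ⟨a', ha'0, ha'a, haa', ha'⟩ := exists_dvd_of_dvd_four_mul ha
  obtain ⟨b', hb'0, hb'b, hbb', hb'⟩ := exists_dvd_of_dvd_four_mul hb
  obtain ⟨m, hm0, hmk, hkm, hm⟩ := exists_dvd_of_dvd_four_mul (Int.natAbs_ne_zero.mpr hk)
  have hm' : ∀ p ∈ F, (m : ℤ) ∣ (p.1 : ℤ) ^ 3 * (b : ℤ) ^ 2 - (p.2 : ℤ) ^ 3 * (a : ℤ) ^ 2 :=
    fun p hp => hm _ (Int.natAbs_dvd.mpr (hF p hp).2.2.2.1)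
  have hmZ : ∀ p ∈ F, (p.1 : ZMod m) ^ 3 * (b : ZMod m) ^ 2 =
      (p.2 : ZMod m) ^ 3 * (a : ZMod m) ^ 2 := by
    intro p hp
    have h := hm' p hp
    rw [← ZMod.intCast_zmod_eq_zero_iff_dvd] at h
    push_cast at h
    exact sub_eq_zero.mp h
  have hu : ∀ p ∈ F, IsUnit (p.1 : ZMod m) ∧ IsUnit (p.2 : ZMod m) ∧ IsUnit (a : ZMod m) ∧
      IsUnit (b : ZMod m) := by
    intro p hp
    obtain ⟨h1, h2, h3, -⟩ := hF p hp
    have h4 := coprime_of_dvd_cube_sub (hm' p hp) h1 h2 hab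
    have h5 := coprime_of_dvd_cube_sub ((dvd_sub_comm).mp (hm' p hp)) h1.symm h3 hab.symm
    simp only [ZMod.isUnit_iff_coprime]
    exact ⟨h4.1.symm, h5.1.symm, h4.2.symm, h5.2.symm⟩
  have hinv : ∀ p ∈ F, (p.2 : ZMod m) * (p.2 : ZMod m)⁻¹ = 1 :=
    fun p hp => ZMod.mul_inv_of_unit _ (hu p hp).2.1
  set key : ℕ × ℕ → ZMod m × ZMod a' × ZMod b' :=
    fun p => ((p.1 : ZMod m) * (p.2 : ZMod m)⁻¹, (p.1 : ZMod a'), (p.2 : ZMod b')) with hkey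
  have himage : (F.image key).card ≤ τ ^ 2 * (τ ^ 2 * τ ^ 2) := by
    have hsub : F.image key ⊆ (F.image fun p => (p.1 : ZMod m) * (p.2 : ZMod m)⁻¹) ×ˢ
        ((F.image fun p => (p.1 : ZMod a')) ×ˢ (F.image fun p => (p.2 : ZMod b'))) := by
      intro x hx
      obtain ⟨p, hp, rfl⟩ := Finset.mem_image.mp hx
      exact Finset.mk_mem_product (Finset.mem_image_of_mem _ hp)
        (Finset.mk_mem_product (Finset.mem_image_of_mem _ hp) (Finset.mem_image_of_mem _ hp))
    refine (Finset.card_le_card hsub).trans ?_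
    rw [Finset.card_product, Finset.card_product]
    refine Nat.mul_le_mul ?_ (Nat.mul_le_mul ?_ ?_)
    · refine le_trans (card_le_of_isUnit_of_cube_eq hm0 _ ?_ ?_)
        (Nat.pow_le_pow_left (hτ m (.inr (.inr hmk))) 2)
      · intro x hx
        obtain ⟨p, hp, rfl⟩ := Finset.mem_image.mp hx
        exact (hu p hp).1.mul (.of_mul_eq_one _ ((mul_comm _ _).trans (hinv p hp)))
      · have hroot : ∀ p ∈ F, ((p.1 : ZMod m) * (p.2 : ZMod m)⁻¹) ^ 3 * (b : ZMod m) ^ 2 =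
            (a : ZMod m) ^ 2 := by
          intro p hp
          calc _ = (p.1 : ZMod m) ^ 3 * (b : ZMod m) ^ 2 * ((p.2 : ZMod m)⁻¹) ^ 3 := by ring
            _ = ((p.2 : ZMod m) * (p.2 : ZMod m)⁻¹) ^ 3 * (a : ZMod m) ^ 2 := by
              rw [hmZ p hp]; ring
            _ = _ := by rw [hinv p hp, one_pow, one_mul]
        intro x hx y hy
        obtain ⟨p, hp, rfl⟩ := Finset.mem_image.mp hx
        obtain ⟨q, hq, rfl⟩ := Finset.mem_image.mp hy
        exact ((hu p hp).2.2.2.pow 2).mul_right_cancel ((hroot p hp).trans (hroot q hq).symm)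
    · exact (card_image_cast_le ha'0 ha'a ha' hab F Prod.fst
        fun p hp => ⟨(hF p hp).2.1, (hF p hp).2.2.2.2.1⟩).trans
        (Nat.pow_le_pow_left (hτ a' (.inl ha'a)) 2)
    · exact (card_image_cast_le hb'0 hb'b hb' hab.symm F Prod.snd
        fun p hp => ⟨(hF p hp).2.2.1, (hF p hp).2.2.2.2.2⟩).trans
        (Nat.pow_le_pow_left (hτ b' (.inr (.inl hb'b))) 2)
  refine (Finset.card_le_mul_card_image (f := key) F (B.card + 1) ?_).trans
    (Nat.mul_le_mul_left _ himage)
  intro c hc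
  obtain ⟨q, hq, rfl⟩ := Finset.mem_image.mp hc
  have hdiff : ∀ {N n : ℕ} {u v : ℕ}, N ∣ 4 * n → (u : ZMod n) = v →
      ∃ x : ℤ, (N : ℤ) * x = 4 * ((u : ℤ) - v) := by
    intro N n u v hN huv
    have h1 : (n : ℤ) ∣ (u : ℤ) - v := by
      rw [← ZMod.intCast_zmod_eq_zero_iff_dvd]
      push_cast
      exact sub_eq_zero.mpr huv
    have h2 : (N : ℤ) ∣ 4 * ((u : ℤ) - v) :=
      (by exact_mod_cast hN : (N : ℤ) ∣ 4 * (n : ℤ)).trans (mul_dvd_mul_left 4 h1)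
    exact ⟨_, h2.choose_spec.symm⟩
  have hex : ∀ p : ↥(F.filter fun p => key p = key q), ∃ z : ℤ × ℤ,
      (a : ℤ) * z.1 = 4 * ((p.1.1 : ℤ) - q.1) ∧ (b : ℤ) * z.2 = 4 * ((p.1.2 : ℤ) - q.2) := by
    intro p
    have hp := (Finset.mem_filter.mp p.2).2
    simp only [hkey, Prod.mk.injEq] at hp
    obtain ⟨x, hx⟩ := hdiff haa' hp.2.1
    obtain ⟨y, hy⟩ := hdiff hbb' hp.2.2
    exact ⟨(x, y), hx, hy⟩
  choose g hg using hex
  refine le_trans ?_ (Finset.card_insert_le (0 : ℤ × ℤ) B)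
  rw [← Fintype.card_coe, ← Fintype.card_coe]
  refine Fintype.card_le_of_injective
    (fun p => (⟨g p, ?_⟩ : ↥(insert (0 : ℤ × ℤ) B))) ?_
  · rw [Finset.mem_insert]
    by_cases h0 : g p = 0
    · exact Or.inl h0
    right
    obtain ⟨hpF, hpk⟩ := Finset.mem_filter.mp p.2
    refine hB _ _ h0 ?_ ⟨p, hpF, q, hq, hg p⟩
    have hcross : (p.1.1 : ZMod m) * (q.2 : ZMod m) = (q.1 : ZMod m) * (p.1.2 : ZMod m) := by
      simp only [hkey, Prod.mk.injEq] at hpk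
      calc (p.1.1 : ZMod m) * (q.2 : ZMod m)
          = (p.1.1 : ZMod m) * (q.2 : ZMod m) * ((p.1.2 : ZMod m) * (p.1.2 : ZMod m)⁻¹) := by
            rw [hinv p hpF, mul_one]
        _ = (p.1.1 : ZMod m) * (p.1.2 : ZMod m)⁻¹ * (q.2 : ZMod m) * (p.1.2 : ZMod m) := by ring
        _ = (q.1 : ZMod m) * (p.1.2 : ZMod m) * ((q.2 : ZMod m) * (q.2 : ZMod m)⁻¹) := by
            rw [hpk.1]; ring
        _ = _ := by rw [hinv q hq, mul_one]
    obtain ⟨hx, hy⟩ := hg p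
    set x := (g p).1
    set y := (g p).2
    have hxZ : (a : ZMod m) * (x : ZMod m) = 4 * ((p.1.1 : ZMod m) - q.1) := by
      have := congrArg (Int.cast : ℤ → ZMod m) hx
      push_cast at this
      exact this
    have hyZ : (b : ZMod m) * (y : ZMod m) = 4 * ((p.1.2 : ZMod m) - q.2) := by
      have := congrArg (Int.cast : ℤ → ZMod m) hy
      push_cast at this
      exact this
    have hlin : (a : ZMod m) * x * q.2 = (b : ZMod m) * y * q.1 := by
      rw [hxZ, hyZ]
      linear_combination 4 * hcross
    obtain ⟨-, hu2, hua, hub⟩ := hu q hq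
    have hcube : (a : ZMod m) * (x : ZMod m) ^ 3 = (b : ZMod m) * (y : ZMod m) ^ 3 := by
      refine (((hua.pow 2).mul (hub.pow 2)).mul (hu2.pow 3)).mul_left_cancel ?_
      calc _ = ((a : ZMod m) * x * q.2) ^ 3 * (b : ZMod m) ^ 2 := by ring
        _ = (b : ZMod m) ^ 3 * (y : ZMod m) ^ 3 * ((q.1 : ZMod m) ^ 3 * (b : ZMod m) ^ 2) := by
          rw [hlin]; ring
        _ = _ := by rw [hmZ q hq]; ring
    have hdvd : (m : ℤ) ∣ a * x ^ 3 - b * y ^ 3 := by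
      rw [← ZMod.intCast_zmod_eq_zero_iff_dvd]
      push_cast
      exact sub_eq_zero.mpr hcube
    refine Int.natAbs_dvd.mp (dvd_trans ?_ (mul_dvd_mul_left 4 hdvd))
    exact_mod_cast hkm
  · intro p p' hpp
    have he : g p = g p' := congrArg Subtype.val hpp
    obtain ⟨h1, h2⟩ := hg p
    obtain ⟨h3, h4⟩ := hg p'
    rw [he] at h1 h2
    refine Subtype.ext (Prod.ext ?_ ?_) <;> omega

/-- Pairs of triples `((w₁, u₁, a), (w₂, u₂, b))` with `wᵢ ≤ H`, `uᵢ ≤ L` and `a, b ≤ A`, obtained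
from two representations `4wᵢ³ = uᵢ² + e vᵢ²` by dividing `v₁` and `v₂` by their common divisor. -/
structure IsReducedPair (H L A : ℕ) (q : (ℕ × ℕ × ℕ) × (ℕ × ℕ × ℕ)) : Prop where
  two_le_w₁ : 2 ≤ q.1.1
  two_le_w₂ : 2 ≤ q.2.1
  w₁_le : q.1.1 ≤ H
  w₂_le : q.2.1 ≤ H
  u₁_le : q.1.2.1 ≤ L
  u₂_le : q.2.2.1 ≤ L
  a_pos : 1 ≤ q.1.2.2
  b_pos : 1 ≤ q.2.2.2
  a_le : q.1.2.2 ≤ A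
  b_le : q.2.2.2 ≤ A
  coprime_w : q.1.1.Coprime q.2.1
  coprime_wa : q.1.1.Coprime q.1.2.2
  coprime_wb : q.2.1.Coprime q.2.2.2
  coprime_ab : q.1.2.2.Coprime q.2.2.2
  dvd_a : (q.1.2.2 : ℤ) ∣ 4 * (q.1.1 : ℤ) ^ 3 - (q.1.2.1 : ℤ) ^ 2
  dvd_b : (q.2.2.2 : ℤ) ∣ 4 * (q.2.1 : ℤ) ^ 3 - (q.2.2.1 : ℤ) ^ 2
  eq : 4 * ((q.1.1 : ℤ) ^ 3 * (q.2.2.2 : ℤ) ^ 2 - (q.2.1 : ℤ) ^ 3 * (q.1.2.2 : ℤ) ^ 2) =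
    ((q.1.2.1 : ℤ) * q.2.2.2 - q.2.2.1 * q.1.2.2) * (q.1.2.1 * q.2.2.2 + q.2.2.1 * q.1.2.2)

namespace IsReducedPair

variable {H L A M τ : ℕ} {q : (ℕ × ℕ × ℕ) × (ℕ × ℕ × ℕ)}

/-- The smaller factor `u₁ b - u₂ a` of `4 (w₁³ b² - w₂³ a²)`. -/
def gap (q : (ℕ × ℕ × ℕ) × (ℕ × ℕ × ℕ)) : ℤ := (q.1.2.1 : ℤ) * q.2.2.2 - q.2.2.1 * q.1.2.2

theorem ne_zero (h : IsReducedPair H L A q) :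
    4 * ((q.1.1 : ℤ) ^ 3 * (q.2.2.2 : ℤ) ^ 2 - (q.2.1 : ℤ) ^ 3 * (q.1.2.2 : ℤ) ^ 2) ≠ 0 := by
  intro h0
  have h1 : q.1.1 ^ 3 * q.2.2.2 ^ 2 = q.2.1 ^ 3 * q.1.2.2 ^ 2 := by
    have : (q.1.1 : ℤ) ^ 3 * (q.2.2.2 : ℤ) ^ 2 = (q.2.1 : ℤ) ^ 3 * (q.1.2.2 : ℤ) ^ 2 := by omega
    exact_mod_cast this
  have h2 : q.1.1 ∣ q.2.1 ^ 3 * q.1.2.2 ^ 2 :=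
    h1 ▸ (dvd_pow_self q.1.1 (by norm_num)).mul_right _
  have h3 := Nat.eq_one_of_dvd_coprimes
    (Nat.Coprime.mul_right (h.coprime_w.pow_right 3) (h.coprime_wa.pow_right 2)) dvd_rfl h2
  have := h.two_le_w₁
  omega

theorem gap_dvd (h : IsReducedPair H L A q) :
    gap q ∣ 4 * ((q.1.1 : ℤ) ^ 3 * (q.2.2.2 : ℤ) ^ 2 - (q.2.1 : ℤ) ^ 3 * (q.1.2.2 : ℤ) ^ 2) :=
  ⟨_, h.eq⟩

theorem gap_ne_zero (h : IsReducedPair H L A q) : gap q ≠ 0 :=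
  fun h0 => h.ne_zero (zero_dvd_iff.mp (h0 ▸ h.gap_dvd))

theorem abs_gap_le (h : IsReducedPair H L A q) : |gap q| ≤ (L * A : ℕ) := by
  have h1 : q.1.2.1 * q.2.2.2 ≤ L * A := Nat.mul_le_mul h.u₁_le h.b_le
  have h2 : q.2.2.1 * q.1.2.2 ≤ L * A := Nat.mul_le_mul h.u₂_le h.a_le
  have h3 : gap q = ((q.1.2.1 * q.2.2.2 : ℕ) : ℤ) - ((q.2.2.1 * q.1.2.2 : ℕ) : ℤ) := by
    simp [gap]
  rw [h3, abs_le]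
  omega

theorem natAbs_le (h : IsReducedPair H L A q) :
    (4 * ((q.1.1 : ℤ) ^ 3 * (q.2.2.2 : ℤ) ^ 2 - (q.2.1 : ℤ) ^ 3 * (q.1.2.2 : ℤ) ^ 2)).natAbs ≤
      512 * H ^ 3 * A ^ 2 := by
  have h1 : q.1.1 ^ 3 * q.2.2.2 ^ 2 ≤ H ^ 3 * A ^ 2 :=
    Nat.mul_le_mul (Nat.pow_le_pow_left h.w₁_le 3) (Nat.pow_le_pow_left h.b_le 2)
  have h2 : q.2.1 ^ 3 * q.1.2.2 ^ 2 ≤ H ^ 3 * A ^ 2 :=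
    Nat.mul_le_mul (Nat.pow_le_pow_left h.w₂_le 3) (Nat.pow_le_pow_left h.a_le 2)
  have h3 : (4 * ((q.1.1 : ℤ) ^ 3 * (q.2.2.2 : ℤ) ^ 2 - (q.2.1 : ℤ) ^ 3 * (q.1.2.2 : ℤ) ^ 2)) =
      4 * (((q.1.1 ^ 3 * q.2.2.2 ^ 2 : ℕ) : ℤ) - ((q.2.1 ^ 3 * q.1.2.2 ^ 2 : ℕ) : ℤ)) := by
    push_cast; ring
  rw [h3, mul_assoc]
  omega

theorem dvd_a_gap (h : IsReducedPair H L A q) :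
    (q.1.2.2 : ℤ) ∣ 4 * (q.1.1 : ℤ) ^ 3 * (q.2.2.2 : ℤ) ^ 2 - gap q ^ 2 := by
  have e : 4 * (q.1.1 : ℤ) ^ 3 * (q.2.2.2 : ℤ) ^ 2 - gap q ^ 2 =
      (4 * (q.1.1 : ℤ) ^ 3 - (q.1.2.1 : ℤ) ^ 2) * (q.2.2.2 : ℤ) ^ 2 +
        q.1.2.2 * (q.2.2.1 * (2 * q.1.2.1 * q.2.2.2 - q.2.2.1 * q.1.2.2)) := by
    unfold gap; ring
  rw [e]
  exact dvd_add (h.dvd_a.mul_right _) (dvd_mul_right _ _)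

theorem dvd_b_gap (h : IsReducedPair H L A q) :
    (q.2.2.2 : ℤ) ∣ 4 * (q.2.1 : ℤ) ^ 3 * (q.1.2.2 : ℤ) ^ 2 - gap q ^ 2 := by
  have e : 4 * (q.2.1 : ℤ) ^ 3 * (q.1.2.2 : ℤ) ^ 2 - gap q ^ 2 =
      (4 * (q.2.1 : ℤ) ^ 3 - (q.2.2.1 : ℤ) ^ 2) * (q.1.2.2 : ℤ) ^ 2 +
        q.2.2.2 * (q.1.2.1 * (2 * q.2.2.1 * q.1.2.2 - q.1.2.1 * q.2.2.2)) := by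
    unfold gap; ring
  rw [e]
  exact dvd_add (h.dvd_b.mul_right _) (dvd_mul_right _ _)

theorem ext_of_gap_eq {q' : (ℕ × ℕ × ℕ) × (ℕ × ℕ × ℕ)} (h : IsReducedPair H L A q)
    (h' : IsReducedPair H L A q') (hw₁ : q.1.1 = q'.1.1) (hw₂ : q.2.1 = q'.2.1)
    (ha : q.1.2.2 = q'.1.2.2) (hb : q.2.2.2 = q'.2.2.2) (hk : gap q = gap q') : q = q' := by
  have e := h.eq
  have e' := h'.eq
  have hk0 := h.gap_ne_zero
  have ha0 := h.a_pos
  have hb0 := h.b_pos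
  obtain ⟨⟨w₁, u₁, a⟩, ⟨w₂, u₂, b⟩⟩ := q
  obtain ⟨⟨w₁', u₁', a'⟩, ⟨w₂', u₂', b'⟩⟩ := q'
  simp only [gap] at *
  subst hw₁ hw₂ ha hb
  rw [e, ← hk] at e'
  have hsum := mul_left_cancel₀ hk0 e'
  have h1 : (u₁ : ℤ) * b = u₁' * b := by linarith
  have h2 : (u₂ : ℤ) * a = u₂' * a := by linarith
  have h3 : (u₁ : ℤ) = u₁' := mul_right_cancel₀ (by positivity) h1
  have h4 : (u₂ : ℤ) = u₂' := mul_right_cancel₀ (by positivity) h2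
  have h5 : u₁ = u₁' := by exact_mod_cast h3
  have h6 : u₂ = u₂' := by exact_mod_cast h4
  rw [h5, h6]

theorem card_le_of_forall_mem (hM : 512 * H ^ 3 * A ^ 2 ≤ M)
    (hτ : ∀ n : ℕ, n ≠ 0 → n ≤ M → n.divisors.card ≤ τ)
    (S : Finset ((ℕ × ℕ × ℕ) × (ℕ × ℕ × ℕ))) (hS : ∀ q ∈ S, IsReducedPair H L A q)
    (Q : Finset (ℕ × ℕ)) (hQ : ∀ q ∈ S, (q.1.2.2, q.2.2.2) ∈ Q) :
    S.card ≤ 2 * τ * (Q.card * H ^ 2) := by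
  classical
  have hmaps : ∀ q ∈ S, ((q.1.2.2, q.2.2.2), (q.1.1, q.2.1)) ∈
      Q ×ˢ (Finset.Icc 1 H ×ˢ Finset.Icc 1 H) := by
    intro q hq
    have h := hS q hq
    have := h.two_le_w₁
    have := h.two_le_w₂
    exact Finset.mk_mem_product (hQ q hq) (Finset.mk_mem_product
      (Finset.mem_Icc.mpr ⟨by omega, h.w₁_le⟩) (Finset.mem_Icc.mpr ⟨by omega, h.w₂_le⟩))
  have hcard : (Q ×ˢ (Finset.Icc 1 H ×ˢ Finset.Icc 1 H)).card = Q.card * H ^ 2 := by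
    simp [Finset.card_product, sq]
  rw [← hcard]
  refine Finset.card_le_mul_card_image_of_maps_to hmaps (2 * τ) ?_
  rintro ⟨⟨a, b⟩, ⟨w₁, w₂⟩⟩ -
  set F := S.filter fun q => ((q.1.2.2, q.2.2.2), (q.1.1, q.2.1)) = ((a, b), (w₁, w₂)) with hF
  have hFS : ∀ q ∈ F, IsReducedPair H L A q ∧ q.1.2.2 = a ∧ q.2.2.2 = b ∧ q.1.1 = w₁ ∧
      q.2.1 = w₂ := by
    intro q hq
    obtain ⟨h1, h2⟩ := Finset.mem_filter.mp hq
    simp only [Prod.mk.injEq] at h2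
    exact ⟨hS q h1, h2.1.1, h2.1.2, h2.2.1, h2.2.2⟩
  rcases F.eq_empty_or_nonempty with h0 | ⟨q₀, hq₀⟩
  · simp [h0]
  obtain ⟨h, rfl, rfl, rfl, rfl⟩ := hFS q₀ hq₀
  have hinj : Set.InjOn gap (F : Set ((ℕ × ℕ × ℕ) × (ℕ × ℕ × ℕ))) := by
    intro q hq q' hq' he
    obtain ⟨h1, ha, hb, hw, hw'⟩ := hFS q hq
    obtain ⟨h2, ha', hb', hv, hv'⟩ := hFS q' hq'
    exact h1.ext_of_gap_eq h2 (hw.trans hv.symm) (hw'.trans hv'.symm) (ha.trans ha'.symm)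
      (hb.trans hb'.symm) he
  rw [← Finset.card_image_of_injOn hinj]
  refine (card_le_two_mul_card_divisors h.ne_zero _ ?_).trans (Nat.mul_le_mul_left 2
    (hτ _ (Int.natAbs_ne_zero.mpr h.ne_zero) (h.natAbs_le.trans hM)))
  intro k hk
  obtain ⟨q, hq, rfl⟩ := Finset.mem_image.mp hk
  obtain ⟨h1, ha, hb, hw, hw'⟩ := hFS q hq
  have := h1.gap_dvd
  rwa [ha, hb, hw, hw'] at this

end IsReducedPair

theorem exists_eq_cube_of_mul_cube_eq {a b : ℕ} (hab : a.Coprime b) (hb : b ≠ 0)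
    {x y : ℤ} (hxy : (x, y) ≠ 0) (h : (a : ℤ) * x ^ 3 = b * y ^ 3) :
    ∃ r s : ℕ, a = r ^ 3 ∧ b = s ^ 3 := by
  have hN : a * x.natAbs ^ 3 = b * y.natAbs ^ 3 := by
    have := congrArg Int.natAbs h
    simpa [Int.natAbs_mul, Int.natAbs_pow] using this
  have hx : 0 < x.natAbs := by
    refine Nat.pos_of_ne_zero fun hx0 => hxy ?_
    rw [hx0] at hN
    have hy0 : y.natAbs = 0 := by
      by_contra hy
      have : b * y.natAbs ^ 3 ≠ 0 := mul_ne_zero hb (pow_ne_zero _ hy)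
      simp_all
    exact Prod.ext (Int.natAbs_eq_zero.mp hx0) (Int.natAbs_eq_zero.mp hy0)
  obtain ⟨g, x', y', hg, hcop, hx', hy'⟩ := Nat.exists_coprime' (n := y.natAbs)
    (Nat.gcd_pos_of_pos_left _ hx)
  have hred : a * x' ^ 3 = b * y' ^ 3 := by
    rw [hx', hy', mul_pow, mul_pow, ← mul_assoc, ← mul_assoc] at hN
    exact Nat.eq_of_mul_eq_mul_right (pow_pos hg 3) hN
  refine ⟨y', x', Nat.dvd_antisymm ?_ ?_, Nat.dvd_antisymm ?_ ?_⟩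
  · exact hab.dvd_of_dvd_mul_left (hred ▸ dvd_mul_right _ _)
  · exact (hcop.symm.pow 3 3).dvd_of_dvd_mul_right (hred ▸ dvd_mul_left _ _)
  · exact hab.symm.dvd_of_dvd_mul_left (hred ▸ dvd_mul_right _ _)
  · exact (hcop.pow 3 3).dvd_of_dvd_mul_right (hred ▸ dvd_mul_left _ _)

theorem natAbs_four_mul_sub_le {a b H A : ℕ} (ha : 1 ≤ a) (hb : 1 ≤ b) (hA : 1 ≤ A) {x y : ℤ}
    (hx : a * x.natAbs ≤ 4 * H) (hy : b * y.natAbs ≤ 4 * H) :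
    (4 * (a * x ^ 3 - b * y ^ 3)).natAbs ≤ 512 * H ^ 3 * A ^ 2 := by
  have key : ∀ {c : ℕ} {z : ℤ}, 1 ≤ c → c * z.natAbs ≤ 4 * H →
      ((c : ℤ) * z ^ 3).natAbs ≤ 64 * H ^ 3 := by
    intro c z hc hz
    rw [Int.natAbs_mul, Int.natAbs_pow, Int.natAbs_natCast]
    calc c * z.natAbs ^ 3 ≤ c ^ 3 * z.natAbs ^ 3 :=
          Nat.mul_le_mul_right _ (Nat.le_self_pow (by norm_num) c)
      _ = (c * z.natAbs) ^ 3 := (mul_pow _ _ _).symm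
      _ ≤ (4 * H) ^ 3 := Nat.pow_le_pow_left hz 3
      _ = 64 * H ^ 3 := by ring
  have h1 := key ha hx
  have h2 := key hb hy
  have h3 : 512 * H ^ 3 * 1 ≤ 512 * H ^ 3 * A ^ 2 :=
    Nat.mul_le_mul_left _ (Nat.one_le_pow _ _ hA)
  omega

namespace IsReducedPair

variable {H L A M τ : ℕ}

theorem card_fixed_le (hM : 512 * H ^ 3 * A ^ 2 ≤ M) (hLM : L * A ≤ M) (hH : 1 ≤ H)
    (hτ : ∀ n : ℕ, n ≠ 0 → n ≤ M → n.divisors.card ≤ τ) {a b : ℕ}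
    (hab : ¬ ∃ r s : ℕ, a = r ^ 3 ∧ b = s ^ 3)
    (S : Finset ((ℕ × ℕ × ℕ) × (ℕ × ℕ × ℕ)))
    (hS : ∀ q ∈ S, IsReducedPair H L A q ∧ q.1.2.2 = a ∧ q.2.2.2 = b) :
    S.card ≤ τ ^ 2 * (τ ^ 2 * τ ^ 2) *
      (2 * (L * A) + 1 + 2 * τ * ((2 * (4 * H / a) + 1) * (2 * (4 * H / b) + 1))) := by
  classical
  rcases S.eq_empty_or_nonempty with h0 | ⟨q₀, hq₀⟩
  · simp [h0]
  obtain ⟨hr, ha₀, hb₀⟩ := hS q₀ hq₀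
  have ha1 : 1 ≤ a := ha₀ ▸ hr.a_pos
  have hb1 : 1 ≤ b := hb₀ ▸ hr.b_pos
  have haA : a ≤ A := ha₀ ▸ hr.a_le
  have hbA : b ≤ A := hb₀ ▸ hr.b_le
  have hcop : a.Coprime b := ha₀ ▸ hb₀ ▸ hr.coprime_ab
  have hA1 : 1 ≤ A := ha1.trans haA
  have hAM : A ≤ M := by
    refine le_trans ?_ hM
    have h1 : 1 ≤ H ^ 3 := Nat.one_le_pow _ _ hH
    nlinarith
  set I : ℕ → Finset ℤ := fun n => Finset.Icc (-((4 * H / n : ℕ) : ℤ)) ((4 * H / n : ℕ) : ℤ)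
    with hI
  have hIcard : ∀ n, (I n).card = 2 * (4 * H / n) + 1 := by
    intro n
    rw [hI, Int.card_Icc]
    omega
  have hmemI : ∀ {n : ℕ} {z : ℤ}, 1 ≤ n → (z ∈ I n ↔ n * z.natAbs ≤ 4 * H) := by
    intro n z hn
    rw [hI, Finset.mem_Icc, ← abs_le, Int.abs_eq_natAbs, Int.ofNat_le,
      Nat.le_div_iff_mul_le (by omega), mul_comm]
  set D : Finset (ℤ × ℤ) := (I a ×ˢ I b).filter fun z => z ≠ 0 with hD
  set K : Finset ℤ := Finset.Icc (-((L * A : ℕ) : ℤ)) ((L * A : ℕ) : ℤ) with hK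
  set rel : ℤ → ℤ × ℤ → Prop := fun k z => k ∣ 4 * (a * z.1 ^ 3 - b * z.2 ^ 3) with hrel
  have hfib : ∀ k ∈ K, (S.filter fun q => gap q = k).card ≤
      ((D.filter (rel k)).card + 1) * (τ ^ 2 * (τ ^ 2 * τ ^ 2)) := by
    intro k hk
    set F := S.filter fun q => gap q = k with hF
    rcases F.eq_empty_or_nonempty with h0 | ⟨q₁, hq₁⟩
    · simp [h0]
    have hFS : ∀ q ∈ F, IsReducedPair H L A q ∧ q.1.2.2 = a ∧ q.2.2.2 = b ∧ gap q = k := by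
      intro q hq
      obtain ⟨h1, h2⟩ := Finset.mem_filter.mp hq
      exact ⟨(hS q h1).1, (hS q h1).2.1, (hS q h1).2.2, h2⟩
    obtain ⟨hr₁, -, -, hk₁⟩ := hFS q₁ hq₁
    have hk0 : k ≠ 0 := hk₁ ▸ hr₁.gap_ne_zero
    have hkM : k.natAbs ≤ M := by
      have := hr₁.abs_gap_le
      rw [hk₁, Int.abs_eq_natAbs, Int.ofNat_le] at this
      exact this.trans hLM
    have hinj : Set.InjOn (fun q : (ℕ × ℕ × ℕ) × (ℕ × ℕ × ℕ) => (q.1.1, q.2.1))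
        (F : Set ((ℕ × ℕ × ℕ) × (ℕ × ℕ × ℕ))) := by
      intro q hq q' hq' he
      obtain ⟨h1, h2, h3, h4⟩ := hFS q hq
      obtain ⟨h1', h2', h3', h4'⟩ := hFS q' hq'
      simp only [Prod.mk.injEq] at he
      exact h1.ext_of_gap_eq h1' he.1 he.2 (h2.trans h2'.symm) (h3.trans h3'.symm)
        (h4.trans h4'.symm)
    rw [← Finset.card_image_of_injOn hinj]
    refine card_fiber_le (a := a) (b := b) (k := k) (by omega) (by omega) hk0 hcop ?_ _ ?_ _ ?_
    · rintro n (hn | hn | hn)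
      · exact hτ n (ne_zero_of_dvd_ne_zero (by omega) hn)
          ((Nat.le_of_dvd (by omega) hn).trans (haA.trans hAM))
      · exact hτ n (ne_zero_of_dvd_ne_zero (by omega) hn)
          ((Nat.le_of_dvd (by omega) hn).trans (hbA.trans hAM))
      · exact hτ n (ne_zero_of_dvd_ne_zero (by omega) hn)
          ((Nat.le_of_dvd (by omega) hn).trans hkM)
    · intro p hp
      obtain ⟨q, hq, rfl⟩ := Finset.mem_image.mp hp
      obtain ⟨h, rfl, rfl, rfl⟩ := hFS q hq
      exact ⟨h.coprime_w, h.coprime_wa, h.coprime_wb, h.gap_dvd, h.dvd_a_gap, h.dvd_b_gap⟩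
    · rintro x y hxy hdvd ⟨p, hp, p', hp', hx, hy⟩
      obtain ⟨q, hq, rfl⟩ := Finset.mem_image.mp hp
      obtain ⟨q', hq', rfl⟩ := Finset.mem_image.mp hp'
      have h := (hFS q hq).1
      have h' := (hFS q' hq').1
      have hdiff : ∀ {n u v : ℕ} {z : ℤ}, u ≤ H → v ≤ H → (n : ℤ) * z = 4 * ((u : ℤ) - v) →
          n * z.natAbs ≤ 4 * H := by
        intro n u v z hu hv hz
        have := congrArg Int.natAbs hz
        rw [Int.natAbs_mul, Int.natAbs_natCast] at this
        omega
      refine Finset.mem_filter.mpr ⟨Finset.mem_filter.mpr ⟨Finset.mk_mem_product ?_ ?_, hxy⟩, hdvd⟩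
      · exact (hmemI ha1).mpr (hdiff h.w₁_le h'.w₁_le hx)
      · exact (hmemI hb1).mpr (hdiff h.w₂_le h'.w₂_le hy)
  have hsum : ∑ k ∈ K, (D.filter (rel k)).card ≤
      2 * τ * ((2 * (4 * H / a) + 1) * (2 * (4 * H / b) + 1)) := by
    have hswap : ∑ k ∈ K, (D.filter (rel k)).card = ∑ z ∈ D, (K.filter fun k => rel k z).card :=
      Finset.sum_card_bipartiteAbove_eq_sum_card_bipartiteBelow rel
    rw [hswap]
    have hDcard : D.card ≤ (2 * (4 * H / a) + 1) * (2 * (4 * H / b) + 1) := by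
      rw [← hIcard, ← hIcard, ← Finset.card_product]
      exact Finset.card_filter_le _ _
    refine (Finset.sum_le_card_nsmul D _ (2 * τ) fun z hz => ?_).trans ?_
    · obtain ⟨hz1, hz0⟩ := Finset.mem_filter.mp hz
      obtain ⟨hx, hy⟩ := Finset.mem_product.mp hz1
      have hne : 4 * ((a : ℤ) * z.1 ^ 3 - b * z.2 ^ 3) ≠ 0 := by
        intro h0
        exact hab (exists_eq_cube_of_mul_cube_eq hcop (by omega) hz0 (by omega))
      refine (card_le_two_mul_card_divisors hne _ fun k hk => (Finset.mem_filter.mp hk).2).trans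
        (Nat.mul_le_mul_left 2 (hτ _ (Int.natAbs_ne_zero.mpr hne) (le_trans ?_ hM)))
      exact natAbs_four_mul_sub_le ha1 hb1 hA1 ((hmemI ha1).mp hx) ((hmemI hb1).mp hy)
    · rw [smul_eq_mul, mul_comm]
      exact Nat.mul_le_mul_left _ hDcard
  have hKcard : K.card = 2 * (L * A) + 1 := by
    rw [hK, Int.card_Icc]
    omega
  have hmaps : ∀ q ∈ S, gap q ∈ K := by
    intro q hq
    rw [hK, Finset.mem_Icc, ← abs_le]
    exact (hS q hq).1.abs_gap_le
  rw [Finset.card_eq_sum_card_fiberwise hmaps]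
  refine (Finset.sum_le_sum hfib).trans ?_
  rw [← Finset.sum_mul, Finset.sum_add_distrib, Finset.sum_const, smul_eq_mul, mul_one, hKcard,
    mul_comm]
  refine Nat.mul_le_mul_left _ ?_
  omega

theorem card_le (hM : 512 * H ^ 3 * A ^ 2 ≤ M) (hLM : L * A ≤ M) (hH : 1 ≤ H)
    (hτ : ∀ n : ℕ, n ≠ 0 → n ≤ M → n.divisors.card ≤ τ) {c : ℕ}
    (hc : ∀ r : ℕ, r ^ 3 ≤ A → r ≤ c)
    (S : Finset ((ℕ × ℕ × ℕ) × (ℕ × ℕ × ℕ))) (hS : ∀ q ∈ S, IsReducedPair H L A q) :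
    S.card ≤ 2 * τ * (c ^ 2 * H ^ 2) + τ ^ 2 * (τ ^ 2 * τ ^ 2) *
      (A ^ 2 * (2 * (L * A) + 1) + 2 * τ * (∑ a ∈ Finset.Icc 1 A, (2 * (4 * H / a) + 1)) ^ 2) := by
  classical
  set P : (ℕ × ℕ × ℕ) × (ℕ × ℕ × ℕ) → Prop :=
    fun q => ∃ r s : ℕ, q.1.2.2 = r ^ 3 ∧ q.2.2.2 = s ^ 3 with hP
  rw [← Finset.card_filter_add_card_filter_not (s := S) P]
  refine add_le_add ?_ ?_
  · set Q : Finset (ℕ × ℕ) :=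
      (Finset.Icc 1 c ×ˢ Finset.Icc 1 c).image fun z => (z.1 ^ 3, z.2 ^ 3) with hQ
    have hQcard : Q.card ≤ c ^ 2 := by
      refine Finset.card_image_le.trans ?_
      simp [Finset.card_product, sq]
    refine (card_le_of_forall_mem hM hτ _ (fun q hq => hS q (Finset.mem_filter.mp hq).1) Q
      fun q hq => ?_).trans (Nat.mul_le_mul_left _ (Nat.mul_le_mul_right _ hQcard))
    obtain ⟨hq, r, s, hr, hs⟩ := Finset.mem_filter.mp hq
    have h := hS q hq
    have hpos : ∀ {t n : ℕ}, 1 ≤ n → n = t ^ 3 → 1 ≤ t := by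
      intro t n hn ht
      refine Nat.pos_of_ne_zero fun h0 => ?_
      rw [h0] at ht
      omega
    refine Finset.mem_image.mpr ⟨(r, s), Finset.mk_mem_product ?_ ?_, by rw [hr, hs]⟩
    · exact Finset.mem_Icc.mpr ⟨hpos h.a_pos hr, hc r (hr ▸ h.a_le)⟩
    · exact Finset.mem_Icc.mpr ⟨hpos h.b_pos hs, hc s (hs ▸ h.b_le)⟩
  · set T := S.filter fun q => ¬ P q with hT
    have hmaps : ∀ q ∈ T, (q.1.2.2, q.2.2.2) ∈ Finset.Icc 1 A ×ˢ Finset.Icc 1 A := by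
      intro q hq
      have h := hS q (Finset.mem_filter.mp hq).1
      exact Finset.mk_mem_product (Finset.mem_Icc.mpr ⟨h.a_pos, h.a_le⟩)
        (Finset.mem_Icc.mpr ⟨h.b_pos, h.b_le⟩)
    rw [Finset.card_eq_sum_card_fiberwise hmaps]
    have hfib : ∀ z ∈ Finset.Icc 1 A ×ˢ Finset.Icc 1 A,
        (T.filter fun q => (q.1.2.2, q.2.2.2) = z).card ≤ τ ^ 2 * (τ ^ 2 * τ ^ 2) *
          (2 * (L * A) + 1 + 2 * τ * ((2 * (4 * H / z.1) + 1) * (2 * (4 * H / z.2) + 1))) := by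
      rintro ⟨a, b⟩ -
      by_cases hab : ∃ r s : ℕ, a = r ^ 3 ∧ b = s ^ 3
      · rw [Finset.card_eq_zero.mpr]
        · exact Nat.zero_le _
        refine Finset.filter_eq_empty_iff.mpr fun q hq he => ?_
        simp only [Prod.mk.injEq] at he
        refine (Finset.mem_filter.mp hq).2 ?_
        rw [hP]
        simpa only [he.1, he.2] using hab
      · refine card_fixed_le hM hLM hH hτ hab _ fun q hq => ?_
        obtain ⟨h1, h2⟩ := Finset.mem_filter.mp hq
        simp only [Prod.mk.injEq] at h2
        exact ⟨hS q (Finset.mem_filter.mp h1).1, h2.1, h2.2⟩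
    refine (Finset.sum_le_sum hfib).trans (le_of_eq ?_)
    rw [← Finset.mul_sum, Finset.sum_add_distrib, ← Finset.mul_sum, sq (∑ a ∈ _, _),
      Finset.sum_mul_sum, ← Finset.sum_product', Finset.sum_const, Finset.card_product,
      Nat.card_Icc, smul_eq_mul, Nat.add_sub_cancel, sq A]

end IsReducedPair

theorem setOf_isReducedPair_finite (H L A : ℕ) : {q | IsReducedPair H L A q}.Finite := by
  refine Set.Finite.subset (((Set.finite_Iic H).prod ((Set.finite_Iic L).prod
    (Set.finite_Iic A))).prod ((Set.finite_Iic H).prod ((Set.finite_Iic L).prod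
    (Set.finite_Iic A)))) fun q hq => ?_
  exact ⟨⟨hq.w₁_le, hq.u₁_le, hq.a_le⟩, ⟨hq.w₂_le, hq.u₂_le, hq.b_le⟩⟩

theorem T3delta_le_card_isReducedPair {X Z : ℝ} {δ : ℕ} (hZ : 1 < Z) (hδ : 1 ≤ δ) :
    T3delta X Z δ ≤ Nat.card {q // IsReducedPair ⌊4 * Z ^ 2⌋₊ ⌊2 ^ 4 * Z ^ 3⌋₊
      ⌊2 ^ 4 * Z ^ 3 * X ^ (-(1 : ℝ) / 2) / δ⌋₊ q} := by
  have := (setOf_isReducedPair_finite ⌊4 * Z ^ 2⌋₊ ⌊2 ^ 4 * Z ^ 3⌋₊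
      ⌊2 ^ 4 * Z ^ 3 * X ^ (-(1 : ℝ) / 2) / δ⌋₊).to_subtype
  have hδ0 : (0 : ℝ) < δ := by exact_mod_cast hδ
  refine Nat.card_le_card_of_injective
    (β := {q // q ∈ {q | IsReducedPair ⌊4 * Z ^ 2⌋₊ ⌊2 ^ 4 * Z ^ 3⌋₊
      ⌊2 ^ 4 * Z ^ 3 * X ^ (-(1 : ℝ) / 2) / δ⌋₊ q}})
    (fun t => ⟨((t.1.1.1, t.1.1.2.1, t.1.1.2.2 / δ), (t.1.2.1, t.1.2.2.1, t.1.2.2.2 / δ)), ?_⟩) ?_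
  · obtain ⟨⟨⟨w₁, u₁, v₁⟩, ⟨w₂, u₂, v₂⟩⟩, -, hs, ⟨e, -, -, -, -, he₁, he₂⟩, hw, hδv⟩ := t
    obtain ⟨hw₁, hw₁', -, hu₁, hv₁, hv₁', -, hc₁, -⟩ := hs (w₁, u₁, v₁) (by simp)
    obtain ⟨hw₂, hw₂', -, hu₂, hv₂, hv₂', -, hc₂, -⟩ := hs (w₂, u₂, v₂) (by simp)
    dsimp only at *
    obtain ⟨a, ha⟩ : δ ∣ v₁ := hδv ▸ Nat.gcd_dvd_left _ _
    obtain ⟨b, hb⟩ : δ ∣ v₂ := hδv ▸ Nat.gcd_dvd_right _ _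
    have hva : v₁ / δ = a := by rw [ha, Nat.mul_div_cancel_left _ hδ]
    have hvb : v₂ / δ = b := by rw [hb, Nat.mul_div_cancel_left _ hδ]
    have hZ2 : 1 < Z ^ 2 := one_lt_pow₀ hZ (by norm_num)
    have hfloor : ∀ {v c : ℕ}, v = δ * c → (v : ℝ) ≤ 2 ^ 4 * Z ^ 3 * X ^ (-(1 : ℝ) / 2) →
        c ≤ ⌊2 ^ 4 * Z ^ 3 * X ^ (-(1 : ℝ) / 2) / δ⌋₊ := by
      intro v c hvc hv
      refine Nat.le_floor ?_
      rw [le_div_iff₀ hδ0]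
      rw [hvc] at hv
      push_cast at hv
      linarith
    have hpos : ∀ {v c : ℕ}, v = δ * c → 0 < v → 1 ≤ c := by
      intro v c hvc hv
      exact Nat.pos_of_mul_pos_left (hvc ▸ hv)
    rw [hva, hvb]
    have hv₁Z : (v₁ : ℤ) = δ * a := by exact_mod_cast ha
    have hv₂Z : (v₂ : ℤ) = δ * b := by exact_mod_cast hb
    rw [hv₁Z] at he₁
    rw [hv₂Z] at he₂
    exact
      { two_le_w₁ := by
          have : (1 : ℝ) < w₁ := hZ2.trans_le hw₁
          exact_mod_cast this
        two_le_w₂ := by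
          have : (1 : ℝ) < w₂ := hZ2.trans_le hw₂
          exact_mod_cast this
        w₁_le := Nat.le_floor hw₁'.le
        w₂_le := Nat.le_floor hw₂'.le
        u₁_le := Nat.le_floor hu₁
        u₂_le := Nat.le_floor hu₂
        a_pos := hpos ha hv₁
        b_pos := hpos hb hv₂
        a_le := hfloor ha hv₁'
        b_le := hfloor hb hv₂'
        coprime_w := hw
        coprime_wa := (Nat.Coprime.of_dvd_right (Dvd.intro_left δ ha.symm) hc₁ : w₁.Coprime a)
        coprime_wb := (Nat.Coprime.of_dvd_right (Dvd.intro_left δ hb.symm) hc₂ : w₂.Coprime b)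
        coprime_ab := by
          rw [ha, hb, Nat.gcd_mul_left] at hδv
          exact Nat.eq_of_mul_eq_mul_left hδ (hδv.trans (mul_one δ).symm)
        dvd_a := ⟨e * δ ^ 2 * a, by rw [he₁]; ring⟩
        dvd_b := ⟨e * δ ^ 2 * b, by rw [he₂]; ring⟩
        eq := by
          dsimp only
          linear_combination (b : ℤ) ^ 2 * he₁ - (a : ℤ) ^ 2 * he₂ }
  · rintro ⟨⟨⟨w₁, u₁, v₁⟩, ⟨w₂, u₂, v₂⟩⟩, ht⟩ ⟨⟨⟨w₁', u₁', v₁'⟩, ⟨w₂', u₂', v₂'⟩⟩, ht'⟩ h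
    have h1 := ht.2.2.2.2
    have h2 := ht'.2.2.2.2
    simp only [Subtype.mk.injEq, Prod.mk.injEq] at h h1 h2 ⊢
    obtain ⟨⟨rfl, rfl, ha⟩, rfl, rfl, hb⟩ := h
    have d1 : δ ∣ v₁ := h1 ▸ Nat.gcd_dvd_left _ _
    have d2 : δ ∣ v₂ := h1 ▸ Nat.gcd_dvd_right _ _
    have d1' : δ ∣ v₁' := h2 ▸ Nat.gcd_dvd_left _ _
    have d2' : δ ∣ v₂' := h2 ▸ Nat.gcd_dvd_right _ _
    exact ⟨⟨rfl, rfl, Nat.div_left_inj d1 d1' |>.mp ha⟩, rfl, rfl, Nat.div_left_inj d2 d2' |>.mp hb⟩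

theorem sum_two_mul_div_add_one_le {H A : ℕ} (hAH : A ≤ H) :
    ((∑ a ∈ Finset.Icc 1 A, (2 * (4 * H / a) + 1) : ℕ) : ℝ) ≤ 9 * H * (1 + Real.log A) := by
  have hharm : ((harmonic A : ℚ) : ℝ) = ∑ a ∈ Finset.Icc 1 A, ((a : ℝ))⁻¹ := by
    rw [harmonic_eq_sum_Icc]
    push_cast
    rfl
  refine le_trans ?_ (mul_le_mul_of_nonneg_left (harmonic_le_one_add_log A)
    (by positivity : (0 : ℝ) ≤ 9 * H))
  rw [hharm, Finset.mul_sum]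
  push_cast
  refine Finset.sum_le_sum fun a ha => ?_
  obtain ⟨ha1, haA⟩ := Finset.mem_Icc.mp ha
  have ha0 : (0 : ℝ) < a := by exact_mod_cast ha1
  have h1 : ((4 * H / a : ℕ) : ℝ) ≤ 4 * H / a := by
    have := Nat.cast_div_le (α := ℝ) (m := 4 * H) (n := a)
    push_cast at this
    exact this
  have h2 : (1 : ℝ) ≤ H / a := by
    rw [one_le_div ha0]
    exact_mod_cast haA.trans hAH
  have h3 : 4 * (H : ℝ) / a = 4 * (H / a) := by ring
  have h4 : 9 * (H : ℝ) * (a : ℝ)⁻¹ = 9 * (H / a) := by ring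
  rw [h4]
  rw [h3] at h1
  linarith

theorem card_isReducedPair_le {Z R : ℝ} {M τ : ℕ} (hZ : 1 ≤ Z) (hR : 1 ≤ R) (hτ1 : 1 ≤ τ)
    (hM : 512 * ⌊4 * Z ^ 2⌋₊ ^ 3 * ⌊R⌋₊ ^ 2 ≤ M) (hLM : ⌊2 ^ 4 * Z ^ 3⌋₊ * ⌊R⌋₊ ≤ M)
    (hτ : ∀ n : ℕ, n ≠ 0 → n ≤ M → n.divisors.card ≤ τ) :
    (Nat.card {q // IsReducedPair ⌊4 * Z ^ 2⌋₊ ⌊2 ^ 4 * Z ^ 3⌋₊ ⌊R⌋₊ q} : ℝ) ≤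
      2627 * ((τ : ℝ) ^ 7 * (1 + Real.log R) ^ 2) *
        ((Z ^ 2) ^ 2 * R ^ ((2 : ℝ) / 3) + R ^ 3 * (2 ^ 4 * Z ^ 3)) := by
  classical
  set H := ⌊4 * Z ^ 2⌋₊ with hHdef
  set L := ⌊2 ^ 4 * Z ^ 3⌋₊ with hLdef
  set A := ⌊R⌋₊ with hAdef
  set S := (setOf_isReducedPair_finite H L A).toFinset with hSdef
  have hS : ∀ q ∈ S, IsReducedPair H L A q := fun q hq => by simpa [hSdef] using hq
  have hcard : Nat.card {q // IsReducedPair H L A q} = S.card :=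
    Nat.card_eq_card_finite_toFinset (setOf_isReducedPair_finite H L A)
  rw [hcard]
  have hH : (H : ℝ) ≤ 4 * Z ^ 2 := Nat.floor_le (by positivity)
  have hL : (L : ℝ) ≤ 2 ^ 4 * Z ^ 3 := Nat.floor_le (by positivity)
  have hA : (A : ℝ) ≤ R := Nat.floor_le (by linarith)
  have hA1 : 1 ≤ A := Nat.le_floor (by simpa using hR)
  have hZ2 : 1 ≤ Z ^ 2 := one_le_pow₀ hZ
  have hZ3 : 1 ≤ Z ^ 3 := one_le_pow₀ hZ
  have hH1 : 1 ≤ H := Nat.le_floor (by push_cast; linarith)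
  set T : ℝ := (τ : ℝ) with hT
  have hT1 : 1 ≤ T := Nat.one_le_cast.mpr hτ1
  set ℓ : ℝ := 1 + Real.log R with hℓ
  have hℓ1 : 1 ≤ ℓ := by
    have := Real.log_nonneg hR
    linarith
  set D : ℝ := R ^ ((2 : ℝ) / 3) with hD
  have hD1 : 1 ≤ D := Real.one_le_rpow hR (by norm_num)
  set U : ℝ := 2 ^ 4 * Z ^ 3 with hU
  have hU1 : 1 ≤ U := by rw [hU]; linarith
  have hE : 1 ≤ T ^ 7 * ℓ ^ 2 := one_le_mul_of_one_le_of_one_le (one_le_pow₀ hT1) (one_le_pow₀ hℓ1)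
  have hTE : T ≤ T ^ 7 * ℓ ^ 2 :=
    (le_self_pow₀ hT1 (by norm_num)).trans
      (le_mul_of_one_le_right (by positivity) (one_le_pow₀ hℓ1))
  have hT6E : T ^ 6 ≤ T ^ 7 * ℓ ^ 2 :=
    (pow_le_pow_right₀ hT1 (by norm_num)).trans
      (le_mul_of_one_le_right (by positivity) (one_le_pow₀ hℓ1))
  set E : ℝ := T ^ 7 * ℓ ^ 2 with hEdef
  have hR0 : 0 ≤ R := by linarith
  rcases le_or_gt R Z with hRZ | hRZ
  · have hAH : A ≤ H := by
      refine Nat.le_floor (hA.trans (hRZ.trans ?_))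
      nlinarith
    have hc : ∀ r : ℕ, r ^ 3 ≤ A → r ≤ ⌊R ^ ((1 : ℝ) / 3)⌋₊ := by
      intro r hr
      refine Nat.le_floor ?_
      have h1 : (r : ℝ) ^ 3 ≤ R := le_trans (by exact_mod_cast hr) hA
      calc (r : ℝ) = ((r : ℝ) ^ (3 : ℕ)) ^ ((1 : ℝ) / 3) := by
            rw [← Real.rpow_natCast, ← Real.rpow_mul (by positivity)]
            norm_num
        _ ≤ R ^ ((1 : ℝ) / 3) := Real.rpow_le_rpow (by positivity) h1 (by norm_num)
    have hc2 : ((⌊R ^ ((1 : ℝ) / 3)⌋₊ : ℕ) : ℝ) ^ 2 ≤ D := by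
      calc _ ≤ (R ^ ((1 : ℝ) / 3)) ^ 2 := by
            gcongr
            exact Nat.floor_le (by positivity)
        _ = D := by
            rw [hD, ← Real.rpow_natCast, ← Real.rpow_mul hR0]
            norm_num
    have hmain := IsReducedPair.card_le hM hLM hH1 hτ hc S hS
    have hG := sum_two_mul_div_add_one_le hAH
    set G : ℕ := ∑ a ∈ Finset.Icc 1 A, (2 * (4 * H / a) + 1) with hGdef
    have hGE : (G : ℝ) ≤ 36 * Z ^ 2 * ℓ := by
      refine hG.trans ?_
      have h1 : Real.log A ≤ Real.log R := Real.log_le_log (by exact_mod_cast hA1) hA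
      have h2 : 0 ≤ Real.log A := Real.log_nonneg (by exact_mod_cast hA1)
      calc 9 * (H : ℝ) * (1 + Real.log A) ≤ 9 * (4 * Z ^ 2) * (1 + Real.log R) := by gcongr
        _ = 36 * Z ^ 2 * ℓ := by rw [hℓ]; ring
    have hmain' : (S.card : ℝ) ≤ 2 * T * (((⌊R ^ ((1 : ℝ) / 3)⌋₊ : ℕ) : ℝ) ^ 2 * (H : ℝ) ^ 2) +
        T ^ 2 * (T ^ 2 * T ^ 2) * ((A : ℝ) ^ 2 * (2 * (L * A) + 1) + 2 * T * (G : ℝ) ^ 2) := by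
      rw [hT]
      exact_mod_cast hmain
    have hLA : 2 * ((L : ℝ) * A) + 1 ≤ 3 * (U * R) := by
      have h1 : (L : ℝ) * A ≤ U * R := by gcongr
      have h2 : 1 ≤ U * R := one_le_mul_of_one_le_of_one_le hU1 hR
      linarith
    calc (S.card : ℝ) ≤ 2 * T * (D * (4 * Z ^ 2) ^ 2) +
          T ^ 2 * (T ^ 2 * T ^ 2) * (R ^ 2 * (3 * (U * R)) + 2 * T * (36 * Z ^ 2 * ℓ) ^ 2) := by
          refine hmain'.trans ?_
          gcongr
      _ = 32 * T * ((Z ^ 2) ^ 2 * D) + 3 * T ^ 6 * (R ^ 3 * U) +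
          2592 * E * ((Z ^ 2) ^ 2 * 1) := by
          rw [hEdef]; ring
      _ ≤ 32 * E * ((Z ^ 2) ^ 2 * D) + 3 * E * (R ^ 3 * U) + 2592 * E * ((Z ^ 2) ^ 2 * D) := by
          gcongr
      _ ≤ 2627 * E * ((Z ^ 2) ^ 2 * D + R ^ 3 * U) := by
          have h1 : 0 ≤ E * ((Z ^ 2) ^ 2 * D) := by positivity
          have h2 : 0 ≤ E * (R ^ 3 * U) := by positivity
          nlinarith
  · have hmain := IsReducedPair.card_le_of_forall_mem hM hτ S hS
      (Finset.Icc 1 A ×ˢ Finset.Icc 1 A) fun q hq => Finset.mk_mem_product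
        (Finset.mem_Icc.mpr ⟨(hS q hq).a_pos, (hS q hq).a_le⟩)
        (Finset.mem_Icc.mpr ⟨(hS q hq).b_pos, (hS q hq).b_le⟩)
    rw [Finset.card_product, Nat.card_Icc, Nat.add_sub_cancel] at hmain
    have hmain' : (S.card : ℝ) ≤ 2 * T * ((A : ℝ) * A * (H : ℝ) ^ 2) := by
      rw [hT]
      exact_mod_cast hmain
    calc (S.card : ℝ) ≤ 2 * T * (R * R * (4 * Z ^ 2) ^ 2) := by
          refine hmain'.trans ?_
          gcongr
      _ = 2 * T * (R ^ 2 * Z * U) := by rw [hU]; ring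
      _ ≤ 2 * E * (R ^ 2 * R * U) := by gcongr
      _ ≤ 2627 * E * ((Z ^ 2) ^ 2 * D + R ^ 3 * U) := by
          have h1 : 0 ≤ E * ((Z ^ 2) ^ 2 * D) := by positivity
          have h2 : 0 ≤ E * (R ^ 3 * U) := by positivity
          nlinarith

/-- For every `ε > 0` there is `C = C(ε)`, independent of `X`, `Z` and `δ`, such
that whenever `X ≥ 2`, `X^(1/6) ≤ Z ≤ X` and `1 ≤ δ ≤ V = 2⁴Z³X^(-1/2)`,
`T₃(δ) ≤ C·X^ε·(W²·V^(2/3)·δ^(-2/3) + V³·U·δ^(-3) + W·V·δ^(-1))`,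
where `W = Z²` and `U = 2⁴Z³`. -/
theorem T3delta_bound (ε : ℝ) (hε : 0 < ε) :
    ∃ C : ℝ, 0 < C ∧ ∀ X Z : ℝ, 2 ≤ X →
      X ^ ((1 : ℝ) / 6) ≤ Z → Z ≤ X →
      ∀ δ : ℕ, 1 ≤ δ → (δ : ℝ) ≤ 2 ^ 4 * Z ^ 3 * X ^ (-(1 : ℝ) / 2) →
      (T3delta X Z δ : ℝ) ≤ C * X ^ ε *
        ((Z ^ 2) ^ 2 * (2 ^ 4 * Z ^ 3 * X ^ (-(1 : ℝ) / 2)) ^ ((2 : ℝ) / 3) *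
            (δ : ℝ) ^ (-(2 : ℝ) / 3) +
          (2 ^ 4 * Z ^ 3 * X ^ (-(1 : ℝ) / 2)) ^ (3 : ℕ) * (2 ^ 4 * Z ^ 3) *
            (δ : ℝ) ^ (-(3 : ℝ)) +
          Z ^ 2 * (2 ^ 4 * Z ^ 3 * X ^ (-(1 : ℝ) / 2)) * (δ : ℝ) ^ (-(1 : ℝ))) := by
  obtain ⟨C₀, hC₀, hdiv⟩ := exists_card_divisors_le_rpow (ε / 108) (by positivity)
  set η : ℝ := ε / 108 with hη
  have hη0 : 0 < η := by positivity
  set C₁ : ℝ := C₀ * (2 ^ 24 : ℝ) ^ η with hC₁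
  set C₂ : ℝ := (1 + 1 / η) * (16 : ℝ) ^ η with hC₂
  refine ⟨2627 * (C₁ ^ 7 * C₂ ^ 2), by positivity, ?_⟩
  intro X Z hX hXZ hZX δ hδ hδV
  have hX1 : 1 ≤ X := by linarith
  have hZ1 : 1 < Z := (Real.one_lt_rpow (by linarith) (by norm_num)).trans_le hXZ
  have hδ0 : (0 : ℝ) < δ := by exact_mod_cast hδ
  have hδ1 : (1 : ℝ) ≤ δ := by exact_mod_cast hδ
  have hT := T3delta_le_card_isReducedPair (X := X) hZ1 hδ
  have hV16 : 2 ^ 4 * Z ^ 3 * X ^ (-(1 : ℝ) / 2) ≤ 16 * X ^ 3 := by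
    have h1 : X ^ (-(1 : ℝ) / 2) ≤ 1 := Real.rpow_le_one_of_one_le_of_nonpos hX1 (by norm_num)
    calc 2 ^ 4 * Z ^ 3 * X ^ (-(1 : ℝ) / 2) ≤ 2 ^ 4 * X ^ 3 * 1 := by gcongr
      _ = 16 * X ^ 3 := by ring
  set V : ℝ := 2 ^ 4 * Z ^ 3 * X ^ (-(1 : ℝ) / 2) with hV
  have hV0 : 0 ≤ V := by positivity
  have hR1 : 1 ≤ V / δ := (one_le_div hδ0).mpr hδV
  have hRV : V / δ ≤ 16 * X ^ 3 := (div_le_self hV0 hδ1).trans hV16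
  have hA : ((⌊V / δ⌋₊ : ℕ) : ℝ) ≤ 16 * X ^ 3 := (Nat.floor_le (by linarith)).trans hRV
  have hH : ((⌊4 * Z ^ 2⌋₊ : ℕ) : ℝ) ≤ 4 * X ^ 2 :=
    (Nat.floor_le (by positivity)).trans (by gcongr)
  have hL : ((⌊2 ^ 4 * Z ^ 3⌋₊ : ℕ) : ℝ) ≤ 2 ^ 4 * X ^ 3 :=
    (Nat.floor_le (by positivity)).trans (by gcongr)
  have hMle : 512 * ⌊4 * Z ^ 2⌋₊ ^ 3 * ⌊V / δ⌋₊ ^ 2 ≤ ⌊2 ^ 24 * X ^ 12⌋₊ := by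
    refine Nat.le_floor ?_
    push_cast
    calc _ ≤ 512 * (4 * X ^ 2) ^ 3 * (16 * X ^ 3) ^ 2 := by gcongr
      _ = 2 ^ 23 * X ^ 12 := by ring
      _ ≤ _ := by gcongr <;> norm_num
  have hLMle : ⌊2 ^ 4 * Z ^ 3⌋₊ * ⌊V / δ⌋₊ ≤ ⌊2 ^ 24 * X ^ 12⌋₊ := by
    refine Nat.le_floor ?_
    push_cast
    calc _ ≤ (2 ^ 4 * X ^ 3) * (16 * X ^ 3) := by gcongr
      _ = 2 ^ 8 * X ^ 6 := by ring
      _ ≤ _ := by gcongr <;> norm_num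
  have hYpow : (2 ^ 24 * X ^ 12) ^ η = (2 ^ 24 : ℝ) ^ η * X ^ (12 * η) := by
    rw [Real.mul_rpow (by positivity) (by positivity), ← Real.rpow_natCast X,
      ← Real.rpow_mul (by linarith)]
    norm_num
  set τ : ℕ := ⌊C₁ * X ^ (12 * η)⌋₊ with hτdef
  have hC₁1 : 1 ≤ C₁ := one_le_mul_of_one_le_of_one_le hC₀ (Real.one_le_rpow (by norm_num) hη0.le)
  have hY1 : 1 ≤ X ^ (12 * η) := Real.one_le_rpow hX1 (by positivity)
  have hτ1 : 1 ≤ τ := by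
    refine Nat.le_floor ?_
    push_cast
    exact one_le_mul_of_one_le_of_one_le hC₁1 hY1
  have hτ : ∀ n : ℕ, n ≠ 0 → n ≤ ⌊2 ^ 24 * X ^ 12⌋₊ → n.divisors.card ≤ τ := by
    intro n hn hnM
    refine Nat.le_floor ((hdiv n hn).trans ?_)
    have h1 : (n : ℝ) ≤ 2 ^ 24 * X ^ 12 := (Nat.le_floor_iff (by positivity)).mp hnM
    calc C₀ * (n : ℝ) ^ η ≤ C₀ * (2 ^ 24 * X ^ 12) ^ η := by gcongr
      _ = C₁ * X ^ (12 * η) := by rw [hYpow, hC₁, mul_assoc]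
  have hcard := card_isReducedPair_le hZ1.le hR1 hτ1 hMle hLMle hτ
  have hτle : (τ : ℝ) ≤ C₁ * X ^ (12 * η) := Nat.floor_le (by positivity)
  have hlog : 1 + Real.log (V / δ) ≤ C₂ * X ^ (12 * η) := by
    have h1 : Real.log (V / δ) ≤ (V / δ) ^ η / η := Real.log_le_rpow_div (by positivity) hη0
    have h2 : 1 ≤ (V / δ) ^ η := Real.one_le_rpow hR1 hη0.le
    have h3 : (V / δ) ^ η ≤ (16 : ℝ) ^ η * X ^ (12 * η) := by
      calc (V / δ) ^ η ≤ (16 * X ^ 3) ^ η := by gcongr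
        _ = (16 : ℝ) ^ η * X ^ (3 * η) := by
            rw [Real.mul_rpow (by positivity) (by positivity), ← Real.rpow_natCast X,
              ← Real.rpow_mul (by linarith)]
            norm_num
        _ ≤ _ := by
            gcongr
            norm_num
    calc 1 + Real.log (V / δ) ≤ (1 + 1 / η) * (V / δ) ^ η := by
          rw [add_mul, one_mul, one_div_mul_eq_div]
          exact add_le_add h2 h1
      _ ≤ (1 + 1 / η) * ((16 : ℝ) ^ η * X ^ (12 * η)) := by gcongr
      _ = _ := by rw [hC₂, mul_assoc]
  have hfactor : (τ : ℝ) ^ 7 * (1 + Real.log (V / δ)) ^ 2 ≤ C₁ ^ 7 * C₂ ^ 2 * X ^ ε := by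
    have hlog0 : 0 ≤ Real.log (V / δ) := Real.log_nonneg hR1
    calc _ ≤ (C₁ * X ^ (12 * η)) ^ 7 * (C₂ * X ^ (12 * η)) ^ 2 := by gcongr
      _ = C₁ ^ 7 * C₂ ^ 2 * (X ^ (12 * η)) ^ 9 := by ring
      _ = C₁ ^ 7 * C₂ ^ 2 * X ^ ε := by
          rw [← Real.rpow_natCast (X ^ (12 * η)), ← Real.rpow_mul (by linarith), hη]
          congr 2
          push_cast
          ring
  have hpow₁ : (V / δ) ^ ((2 : ℝ) / 3) = V ^ ((2 : ℝ) / 3) * (δ : ℝ) ^ (-(2 : ℝ) / 3) := by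
    rw [Real.div_rpow hV0 hδ0.le, neg_div, Real.rpow_neg hδ0.le, div_eq_mul_inv]
  have hpow₂ : (V / δ) ^ 3 = V ^ (3 : ℕ) * (δ : ℝ) ^ (-(3 : ℝ)) := by
    rw [div_pow, Real.rpow_neg hδ0.le, div_eq_mul_inv]
    norm_num
  calc (T3delta X Z δ : ℝ) ≤ _ := by exact_mod_cast hT
    _ ≤ _ := hcard
    _ ≤ 2627 * (C₁ ^ 7 * C₂ ^ 2 * X ^ ε) *
        ((Z ^ 2) ^ 2 * (V / δ) ^ ((2 : ℝ) / 3) + (V / δ) ^ 3 * (2 ^ 4 * Z ^ 3)) := by gcongr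
    _ = 2627 * (C₁ ^ 7 * C₂ ^ 2) * X ^ ε * ((Z ^ 2) ^ 2 * V ^ ((2 : ℝ) / 3) *
        (δ : ℝ) ^ (-(2 : ℝ) / 3) + V ^ (3 : ℕ) * (2 ^ 4 * Z ^ 3) * (δ : ℝ) ^ (-(3 : ℝ))) := by
        rw [hpow₁, hpow₂]; ring
    _ ≤ _ := by
        refine mul_le_mul_of_nonneg_left ?_ (by positivity)
        exact le_add_of_nonneg_right (by positivity)
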